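/- arXiv:0911.0105 — 2 statements merged into one kernel-verified Lean document; each statement's English description precedes it below -/
import Mathlib

section
/- Every numerical function f : ℕ → ℕ definable by an additive circuit (i.e. {⊕}-definable) is linearly bounded: there exists k ∈ ℕ such that f(n) ≤ k·n + k for all n ∈ ℕ. -/
noncomputable section
open Classical

/-- `s ⊕ t`: lifted addition on sets of naturals. -/
def setPlus (s t : Set ℕ) : Set ℕ := {u | ∃ m ∈ s, ∃ n ∈ t, u = m + n}

/-- `s ⊗ t`: lifted multiplication on sets of naturals. -/
def setTimes (s t : Set ℕ) : Set ℕ := {u | ∃ m ∈ s, ∃ n ∈ t, u = m * n}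

/-- Sets of naturals definable by (variable-free) arithmetic circuits:
the smallest collection containing `∅`, `ℕ`, all singletons, closed under
union, intersection, complement, `⊕` and `⊗`. -/
inductive ArithDefinable : Set ℕ → Prop
  | empty : ArithDefinable ∅
  | univ : ArithDefinable Set.univ
  | single (k : ℕ) : ArithDefinable {k}
  | union : ∀ {s t : Set ℕ}, ArithDefinable s → ArithDefinable t → ArithDefinable (s ∪ t)
  | inter : ∀ {s t : Set ℕ}, ArithDefinable s → ArithDefinable t → ArithDefinable (s ∩ t)
  | compl : ∀ {s : Set ℕ}, ArithDefinable s → ArithDefinable sᶜ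
  | plus : ∀ {s t : Set ℕ}, ArithDefinable s → ArithDefinable t → ArithDefinable (setPlus s t)
  | times : ∀ {s t : Set ℕ}, ArithDefinable s → ArithDefinable t → ArithDefinable (setTimes s t)

/-- A set-function of arity `k`. -/
abbrev SetFun (k : ℕ) := (Fin k → Set ℕ) → Set ℕ

/-- The `𝒪`-definable functions `ℙ^n → ℙ`, for a collection `O` of set-functions
(given per arity): smallest class containing projections and the constants
`∅`, `ℕ`, `{k}`, closed under pointwise union, intersection, complement, and
composition with functions in `O`. -/
inductive ODef (O : ∀ k, Set (SetFun k)) (n : ℕ) : SetFun n → Prop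
  | proj (i : Fin n) : ODef O n (fun s => s i)
  | empty : ODef O n (fun _ => ∅)
  | univ : ODef O n (fun _ => Set.univ)
  | single (k : ℕ) : ODef O n (fun _ => {k})
  | union : ∀ {F G : SetFun n}, ODef O n F → ODef O n G → ODef O n (fun s => F s ∪ G s)
  | inter : ∀ {F G : SetFun n}, ODef O n F → ODef O n G → ODef O n (fun s => F s ∩ G s)
  | compl : ∀ {F : SetFun n}, ODef O n F → ODef O n (fun s => (F s)ᶜ)
  | comp : ∀ {k : ℕ} {g : SetFun k} {F : Fin k → SetFun n},
      g ∈ O k → (∀ i, ODef O n (F i)) → ODef O n (fun s => g (fun i => F i s))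

/-- `s_{|m} = s ∩ {0,…,m}`. -/
def restrict (s : Set ℕ) (m : ℕ) : Set ℕ := s ∩ {k | k ≤ m}

/-- `F` is `h`-continuous on `D`. -/
def HCont (h : ℕ → ℕ) {n : ℕ} (F : SetFun n) (D : Set (Fin n → Set ℕ)) : Prop :=
  ∀ m : ℕ, ∀ s ∈ D, ∀ t ∈ D,
    (∀ i, restrict (s i) (h m) = restrict (t i) (h m)) →
    restrict (F s) m = restrict (F t) m

/-- `F` is uniformly continuous on `D`. -/
def UnifCont {n : ℕ} (F : SetFun n) (D : Set (Fin n → Set ℕ)) : Prop :=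
  ∃ h : ℕ → ℕ, HCont h F D

/-- `𝒰`: set-functions (of arity `k`) uniformly continuous on the whole space. -/
def Ucal (k : ℕ) : Set (SetFun k) := {g | UnifCont g Set.univ}

/-- `𝒫`: predicates, i.e. set-functions with values among `∅` and `{0}`. -/
def Pcal (k : ℕ) : Set (SetFun k) := {g | ∀ s, g s = ∅ ∨ g s = {0}}

/-- `𝒰 ∪ 𝒫`. -/
def UPcal (k : ℕ) : Set (SetFun k) := Ucal k ∪ Pcal k

/-- `Max(x)`. -/
def MaxFun (x : Set ℕ) : Set ℕ :=
  if x = ∅ then ∅ else if x.Infinite then Set.univ else {sSup x}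

/-- `Card(x)`. -/
def CardFun (x : Set ℕ) : Set ℕ := if x.Finite then {x.ncard} else Set.univ

/-- `↓(x)`. -/
def DownFun (x : Set ℕ) : Set ℕ := {m | ∃ n ∈ x, m ≤ n}

/-- `Sum(x)`. -/
def SumFun (x : Set ℕ) : Set ℕ := if x.Finite then {∑ᶠ n ∈ x, n} else Set.univ

/-- `Prod(x)`. -/
def ProdFun (x : Set ℕ) : Set ℕ := if x.Finite then {∏ᶠ n ∈ x, n} else Set.univ

/-- `Shove(x) = {n - min x : n ∈ x}` (empty for `x = ∅`). -/
def ShoveFun (x : Set ℕ) : Set ℕ := (fun n => n - sInf x) '' x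

/-- `ε(x)`: the test for emptiness. -/
def epsFun (x : Set ℕ) : Set ℕ := if x = ∅ then {0} else ∅

/-- `Fin(x)`: the test for finiteness. -/
def FinFun (x : Set ℕ) : Set ℕ := if x.Finite then {0} else ∅

/-- `⊕` as a set-function of arity 2. -/
def plusFun : SetFun 2 := fun s => setPlus (s 0) (s 1)

/-- `⊗` as a set-function of arity 2. -/
def timesFun : SetFun 2 := fun s => setTimes (s 0) (s 1)

/-- `↓` as a set-function of arity 1. -/
def downFun1 : SetFun 1 := fun s => DownFun (s 0)

/-- `ε` as a set-function of arity 1. -/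
def epsFun1 : SetFun 1 := fun s => epsFun (s 0)

/-- The collection `{⊕, ⊗}`. -/
def arithO : ∀ k, Set (SetFun k)
  | 2 => {plusFun, timesFun}
  | _ => ∅

/-- The collection `{⊕}`. -/
def addO : ∀ k, Set (SetFun k)
  | 2 => {plusFun}
  | _ => ∅

/-- The collection `{⊕, ↓} ∪ 𝒫`. -/
def addDownO : ∀ k, Set (SetFun k)
  | 1 => insert downFun1 (Pcal 1)
  | 2 => insert plusFun (Pcal 2)
  | k => Pcal k

/-- The collection `{⊕, ⊗, ↓} ∪ 𝒫`. -/
def arithDownO : ∀ k, Set (SetFun k)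
  | 1 => insert downFun1 (Pcal 1)
  | 2 => {plusFun, timesFun} ∪ Pcal 2
  | k => Pcal k

/-- The collection `𝒰 ∪ {ε}`. -/
def UEps : ∀ k, Set (SetFun k)
  | 1 => insert epsFun1 (Ucal 1)
  | k => Ucal k

/-- The collection `{⊕, ⊗} ∪ 𝒫`. -/
def arithPO (k : ℕ) : Set (SetFun k) := arithO k ∪ Pcal k

/-- A numerical function `ℕ → ℕ` is `O`-definable if some `O`-definable
set-function maps `{m}` to `{f m}` for every `m`. -/
def NumDef1 (O : ∀ k, Set (SetFun k)) (f : ℕ → ℕ) : Prop :=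
  ∃ F : SetFun 1, ODef O 1 F ∧ ∀ m : ℕ, F (fun _ => {m}) = {f m}

/-- A numerical function `ℕ^k → ℕ` is `O`-definable if some `O`-definable
set-function maps tuples of singletons to the corresponding singleton value. -/
def NumDef (O : ∀ k, Set (SetFun k)) (k : ℕ) (f : (Fin k → ℕ) → ℕ) : Prop :=
  ∃ F : SetFun k, ODef O k F ∧ ∀ m : Fin k → ℕ, F (fun i => ({m i} : Set ℕ)) = {f m}

/-- `f` is regressive: `{f n : f n < n}` is infinite. -/
def Regressive (f : ℕ → ℕ) : Prop := {y | ∃ n, f n = y ∧ y < n}.Infinite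

/-- `f` is semi-regressive: for every `ℓ` there is `n` with `n + ℓ ≤ f n ≤ 2n - 2`. -/
def SemiRegressive (f : ℕ → ℕ) : Prop :=
  ∀ ℓ : ℕ, ∃ n : ℕ, n + ℓ ≤ f n ∧ (f n : ℤ) ≤ 2 * (n : ℤ) - 2

/-- `s` contains either no number or every number from `T` on. -/
def ConstFrom (T : ℕ) (s : Set ℕ) : Prop := (∀ m, T ≤ m → m ∉ s) ∨ (∀ m, T ≤ m → m ∈ s)

namespace ConstFrom

theorem mono {T T' : ℕ} {s : Set ℕ} (h : ConstFrom T s) (hT : T ≤ T') : ConstFrom T' s :=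
  h.imp (fun h m hm => h m (hT.trans hm)) (fun h m hm => h m (hT.trans hm))

theorem compl {T : ℕ} {s : Set ℕ} (h : ConstFrom T s) : ConstFrom T sᶜ :=
  h.symm.imp (fun h m hm hc => hc (h m hm)) (fun h m hm => h m hm)

theorem union {T : ℕ} {s t : Set ℕ} (hs : ConstFrom T s) (ht : ConstFrom T t) :
    ConstFrom T (s ∪ t) := by
  rcases hs with hs | hs
  · rcases ht with ht | ht
    · exact Or.inl fun m hm h => h.elim (hs m hm) (ht m hm)
    · exact Or.inr fun m hm => Or.inr (ht m hm)
  · exact Or.inr fun m hm => Or.inl (hs m hm)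

theorem inter {T : ℕ} {s t : Set ℕ} (hs : ConstFrom T s) (ht : ConstFrom T t) :
    ConstFrom T (s ∩ t) := by
  simpa [Set.compl_union] using (hs.compl.union ht.compl).compl

theorem exists_mem_le {T : ℕ} {s : Set ℕ} (h : ConstFrom T s) (hne : s.Nonempty) :
    ∃ m ∈ s, m ≤ T := by
  obtain ⟨a, ha⟩ := hne
  rcases h with h | h
  · exact ⟨a, ha, le_of_not_ge fun hm => h a hm ha⟩
  · exact ⟨T, h T le_rfl, le_rfl⟩

end ConstFrom

theorem setPlus_comm (s t : Set ℕ) : setPlus s t = setPlus t s := by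
  ext u
  constructor <;> rintro ⟨m, hm, n, hn, rfl⟩ <;> exact ⟨n, hn, m, hm, add_comm _ _⟩

theorem mem_setPlus_of_cofinite {T : ℕ} {s t : Set ℕ} (hs : ∀ m, T ≤ m → m ∈ s)
    (ht : ConstFrom T t) (hne : t.Nonempty) {u : ℕ} (hu : 2 * T ≤ u) : u ∈ setPlus s t := by
  obtain ⟨a, ha, haT⟩ := ht.exists_mem_le hne
  exact ⟨u - a, hs _ (by omega), a, ha, by omega⟩

theorem ConstFrom.plus {T : ℕ} {s t : Set ℕ} (hs : ConstFrom T s) (ht : ConstFrom T t) :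
    ConstFrom (2 * T) (setPlus s t) := by
  rcases s.eq_empty_or_nonempty with rfl | hse
  · exact Or.inl fun _ _ ⟨_, h, _⟩ => h
  rcases t.eq_empty_or_nonempty with rfl | hte
  · exact Or.inl fun _ _ ⟨_, _, _, h, _⟩ => h
  rcases hs with hs' | hs'
  · rcases ht with ht' | ht'
    · refine Or.inl ?_
      rintro _ hm ⟨a, ha, b, hb, rfl⟩
      have h1 : ¬ T ≤ a := fun h => hs' a h ha
      have h2 : ¬ T ≤ b := fun h => ht' b h hb
      omega
    · rw [setPlus_comm]
      exact Or.inr fun m hm => mem_setPlus_of_cofinite ht' (Or.inl hs') hse hm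
  · exact Or.inr fun m hm => mem_setPlus_of_cofinite hs' ht hte hm

/-- The value at `{n}` of an additive circuit is constant from a bound linear in `n` on. -/
theorem ODef.constFrom_linear {F : SetFun 1} (hF : ODef addO 1 F) :
    ∃ k : ℕ, ∀ n : ℕ, ConstFrom (k * (n + 1)) (F fun _ => {n}) := by
  induction hF with
  | proj i =>
    refine ⟨1, fun n => Or.inl fun m hm h => ?_⟩
    simp only [Set.mem_singleton_iff] at h
    omega
  | empty => exact ⟨0, fun n => Or.inl fun m _ h => h⟩
  | univ => exact ⟨0, fun n => Or.inr fun m _ => trivial⟩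
  | single k =>
    refine ⟨k + 1, fun n => Or.inl fun m hm h => ?_⟩
    simp only [Set.mem_singleton_iff] at h
    nlinarith
  | union _ _ ihF ihG =>
    obtain ⟨k, hk⟩ := ihF
    obtain ⟨l, hl⟩ := ihG
    exact ⟨k + l, fun n => ((hk n).mono (Nat.mul_le_mul_right _ (by omega))).union
      ((hl n).mono (Nat.mul_le_mul_right _ (by omega)))⟩
  | inter _ _ ihF ihG =>
    obtain ⟨k, hk⟩ := ihF
    obtain ⟨l, hl⟩ := ihG
    exact ⟨k + l, fun n => ((hk n).mono (Nat.mul_le_mul_right _ (by omega))).inter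
      ((hl n).mono (Nat.mul_le_mul_right _ (by omega)))⟩
  | compl _ ih =>
    obtain ⟨k, hk⟩ := ih
    exact ⟨k, fun n => (hk n).compl⟩
  | @comp k g F hg _ ih =>
    match k, g, F, hg, ih with
    | 0, _, _, hg, _ => exact hg.elim
    | 1, _, _, hg, _ => exact hg.elim
    | _ + 3, _, _, hg, _ => exact hg.elim
    | 2, _, _, hg, ih =>
      obtain rfl := Set.mem_singleton_iff.mp hg
      obtain ⟨k, hk⟩ := ih 0
      obtain ⟨l, hl⟩ := ih 1
      refine ⟨2 * (k + l), fun n => ?_⟩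
      rw [mul_assoc]
      exact ((hk n).mono (Nat.mul_le_mul_right _ (by omega))).plus
        ((hl n).mono (Nat.mul_le_mul_right _ (by omega)))

theorem additive_numerical_linearly_bounded (f : ℕ → ℕ) (hf : NumDef1 addO f) :
    ∃ k : ℕ, ∀ n : ℕ, f n ≤ k * n + k := by
  obtain ⟨F, hF, hval⟩ := hf
  obtain ⟨k, hk⟩ := hF.constFrom_linear
  refine ⟨k, fun n => ?_⟩
  have h := hk n
  rw [hval] at h
  obtain ⟨m, hm, hle⟩ := h.exists_mem_le ⟨f n, rfl⟩
  rw [Set.mem_singleton_iff] at hm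
  rw [← hm]
  exact hle

end
end

section
/- There exists a numerical function f : ℕ → ℕ which is definable by an arithmetic circuit (i.e. {⊕,⊗}-definable) and which is not polynomially bounded: for every c, d ∈ ℕ there exists n with f(n) > c·(n + 1)^d. -/
noncomputable section
open Classical

open Filter in
/-- Exponentials beat polynomials along the geometric sequence `3 ^ j`. -/
theorem exists_mul_pow_lt_two_pow (c d : ℕ) :
    ∃ j : ℕ, c * (3 * 3 ^ j) ^ d < 2 ^ (3 ^ j) := by
  have h : Tendsto (fun x : ℕ => (x : ℝ) ^ d / (2 : ℝ) ^ x) atTop (nhds 0) :=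
    tendsto_pow_const_div_const_pow_of_one_lt d one_lt_two
  have h3 : Tendsto (fun j : ℕ => 3 ^ j) atTop atTop :=
    tendsto_pow_atTop_atTop_of_one_lt (by norm_num)
  have hpos : (0 : ℝ) < 1 / ((c : ℝ) * 3 ^ d + 1) := by positivity
  obtain ⟨j, hj⟩ := ((h.comp h3).eventually (gt_mem_nhds hpos)).exists
  refine ⟨j, ?_⟩
  simp only [Function.comp_apply] at hj
  rw [div_lt_div_iff₀ (by positivity) (by positivity)] at hj
  push_cast at hj
  have hx : (0 : ℝ) ≤ ((3 : ℝ) ^ j) ^ d := by positivity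
  have : (c : ℝ) * (3 * 3 ^ j) ^ d < 2 ^ (3 ^ j) := by
    rw [mul_pow]
    nlinarith
  exact_mod_cast this

/-- The multiplicative order of `2` modulo `3 ^ (j + 1)` is at least `3 ^ j`. -/
theorem three_pow_le_of_dvd_two_pow_sub_one {j k : ℕ} (hk : k ≠ 0)
    (h : 3 ^ (j + 1) ∣ 2 ^ k - 1) : 3 ^ j ≤ k := by
  have h4 : 3 ^ (j + 1) ∣ 4 ^ k - 1 := by
    have h42 : (4 : ℕ) ^ k - 1 = (2 ^ k + 1) * (2 ^ k - 1) := by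
      rw [← Nat.sq_sub_sq, one_pow, ← pow_mul, mul_comm k 2, pow_mul]
      norm_num
    exact h42 ▸ h.mul_left _
  have hval : padicValNat 3 (4 ^ k - 1 ^ k) = padicValNat 3 (4 - 1) + padicValNat 3 k :=
    padicValNat.pow_sub_pow (by norm_num) (by decide) (by norm_num) (by norm_num) hk
  have hne : (4 : ℕ) ^ k - 1 ≠ 0 := by
    have := Nat.one_lt_pow hk (by norm_num : 1 < 4)
    omega
  rw [padicValNat_dvd_iff_le hne] at h4
  norm_num at hval
  exact Nat.le_of_dvd (Nat.pos_of_ne_zero hk) ((padicValNat_dvd_iff_le hk).2 (by omega))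

theorem ODef.setPlus {n : ℕ} {F G : SetFun n} (hF : ODef arithO n F) (hG : ODef arithO n G) :
    ODef arithO n (fun s => _root_.setPlus (F s) (G s)) :=
  ODef.comp (O := arithO) (k := 2) (g := plusFun) (F := ![F, G]) (Or.inl rfl)
    (Fin.forall_fin_two.2 ⟨hF, hG⟩)

theorem ODef.setTimes {n : ℕ} {F G : SetFun n} (hF : ODef arithO n F) (hG : ODef arithO n G) :
    ODef arithO n (fun s => _root_.setTimes (F s) (G s)) :=
  ODef.comp (O := arithO) (k := 2) (g := timesFun) (F := ![F, G]) (Or.inr rfl)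
    (Fin.forall_fin_two.2 ⟨hF, hG⟩)

/-- The singleton of the least element of `x` (empty if `x` is). -/
def minSet (x : Set ℕ) : Set ℕ := x ∩ (setPlus x {0}ᶜ)ᶜ

theorem minSet_eq {x : Set ℕ} (hx : x.Nonempty) : minSet x = {sInf x} := by
  ext u
  simp only [minSet, setPlus, Set.mem_inter_iff, Set.mem_compl_iff, Set.mem_ofPred_eq,
    Set.mem_singleton_iff, not_exists, not_and]
  constructor
  · rintro ⟨hu, h⟩
    have hle := Nat.sInf_le hu
    by_contra hne
    exact h _ (Nat.sInf_mem hx) (u - sInf x) (by omega) (by omega)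
  · rintro rfl
    refine ⟨Nat.sInf_mem hx, fun m hm k hk h => ?_⟩
    have := Nat.sInf_le hm
    omega

theorem ODef.minSet {n : ℕ} {F : SetFun n} (hF : ODef arithO n F) :
    ODef arithO n (fun s => _root_.minSet (F s)) :=
  hF.inter (hF.setPlus (ODef.single 0).compl).compl

/-- The powers of two, as the numbers that have no odd divisor greater than one. -/
def twoPowers : Set ℕ :=
  (setTimes (setPlus {3} (setTimes {2} Set.univ)) Set.univ)ᶜ

theorem mem_twoPowers {u : ℕ} : u ∈ twoPowers ↔ ∃ k, u = 2 ^ k := by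
  simp only [twoPowers, setTimes, setPlus, Set.mem_compl_iff, Set.mem_ofPred_eq,
    Set.mem_singleton_iff, Set.mem_univ, true_and]
  constructor
  · intro h
    have hu : u ≠ 0 := fun h0 => h ⟨3, ⟨3, rfl, 0, ⟨2, rfl, 0, rfl⟩, rfl⟩, 0, by simp [h0]⟩
    obtain ⟨k, m, ⟨r, rfl⟩, rfl⟩ := Nat.exists_eq_two_pow_mul_odd hu
    refine ⟨k, ?_⟩
    rcases r with _ | r
    · simp
    · exact absurd ⟨2 * (r + 1) + 1, ⟨3, rfl, 2 * r, ⟨2, rfl, r, rfl⟩, by ring⟩, 2 ^ k,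
        mul_comm _ _⟩ h
  · rintro ⟨k, rfl⟩ ⟨a, ⟨_, rfl, _, ⟨_, rfl, r, rfl⟩, rfl⟩, b, hb⟩
    obtain ⟨i, -, hi⟩ := (Nat.dvd_prime_pow Nat.prime_two).1 (Dvd.intro b hb.symm)
    rcases i with _ | i
    · omega
    · rw [pow_succ] at hi
      omega

/-- The powers of two greater than one that are congruent to `1` modulo `2 * n + 1`,
when `x = {n}`. -/
def twoPowersModEqOne (x : Set ℕ) : Set ℕ :=
  (twoPowers ∩ {1}ᶜ) ∩
    setPlus {1} (setTimes (setPlus {1} (setTimes {2} x)) Set.univ)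

theorem mem_twoPowersModEqOne {n u : ℕ} :
    u ∈ twoPowersModEqOne {n} ↔ ∃ k ≠ 0, u = 2 ^ k ∧ 2 * n + 1 ∣ 2 ^ k - 1 := by
  simp only [twoPowersModEqOne, Set.mem_inter_iff, mem_twoPowers]
  simp only [setTimes, setPlus, Set.mem_compl_iff, Set.mem_ofPred_eq,
    Set.mem_singleton_iff, Set.mem_univ, true_and]
  constructor
  · rintro ⟨⟨⟨k, rfl⟩, h1⟩, _, rfl, _, ⟨_, ⟨_, rfl, _, ⟨_, rfl, a, ha, rfl⟩, rfl⟩, b, rfl⟩, h⟩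
    refine ⟨k, ?_, rfl, b, ?_⟩
    · rintro rfl
      exact h1 rfl
    · rw [h, Nat.add_sub_cancel_left, add_comm 1 (2 * a), ha]
  · rintro ⟨k, hk, rfl, b, hb⟩
    have h1 := Nat.one_lt_pow hk one_lt_two
    refine ⟨⟨⟨k, rfl⟩, by omega⟩, 1, rfl, _, ⟨_, ⟨1, rfl, _, ⟨2, rfl, n, rfl, rfl⟩, rfl⟩, b, rfl⟩, ?_⟩
    rw [add_comm 1 (2 * n), ← hb]
    omega

theorem twoPowersModEqOne_nonempty (n : ℕ) : (twoPowersModEqOne {n}).Nonempty := by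
  refine ⟨_, mem_twoPowersModEqOne.2 ⟨Nat.totient (2 * n + 1), ?_, rfl, ?_⟩⟩
  · exact (Nat.totient_pos.2 (by omega)).ne'
  · have hc : Nat.Coprime 2 (2 * n + 1) := by simp
    exact (Nat.modEq_iff_dvd' Nat.one_le_two_pow).1 (Nat.ModEq.pow_totient hc).symm

theorem ODef.twoPowersModEqOne {n : ℕ} {F : SetFun n} (hF : ODef arithO n F) :
    ODef arithO n (fun s => _root_.twoPowersModEqOne (F s)) :=
  ((((ODef.single 3).setPlus ((ODef.single 2).setTimes ODef.univ)).setTimes ODef.univ).compl.inter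
    (ODef.single 1).compl).inter
    ((ODef.single 1).setPlus
      (((ODef.single 1).setPlus ((ODef.single 2).setTimes hF)).setTimes ODef.univ))

theorem exists_arith_definable_superpolynomial :
    ∃ f : ℕ → ℕ, NumDef1 arithO f ∧ ∀ c d : ℕ, ∃ n : ℕ, c * (n + 1) ^ d < f n := by
  refine ⟨fun n => sInf (twoPowersModEqOne {n}),
    ⟨_, (ODef.proj 0).twoPowersModEqOne.minSet,
      fun n => minSet_eq (twoPowersModEqOne_nonempty n)⟩, fun c d => ?_⟩
  obtain ⟨j, hj⟩ := exists_mul_pow_lt_two_pow c d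
  obtain ⟨n, hn⟩ : Odd (3 ^ (j + 1)) := Odd.pow (by decide)
  refine ⟨n, ?_⟩
  obtain ⟨k, hk, hmin, hdvd⟩ :=
    mem_twoPowersModEqOne.1 (Nat.sInf_mem (twoPowersModEqOne_nonempty n))
  have hle : n + 1 ≤ 3 * 3 ^ j := by
    rw [pow_succ] at hn
    have := Nat.pos_of_ne_zero (pow_ne_zero j (by norm_num : (3 : ℕ) ≠ 0))
    omega
  calc c * (n + 1) ^ d ≤ c * (3 * 3 ^ j) ^ d := by gcongr
    _ < 2 ^ (3 ^ j) := hj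
    _ ≤ 2 ^ k := Nat.pow_le_pow_right two_pos
      (three_pow_le_of_dvd_two_pow_sub_one hk (hn ▸ hdvd))
    _ = sInf (twoPowersModEqOne {n}) := hmin.symm

end
end
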